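/- Let F ⊆ (Fin m → ℕ) be hereditary and an M♮-convex set, let X be a finite set of contracts with a map col : X → Fin m, and let w : X → ℝ be injective with w(x) > 0 for all x. Let X' ⊆ X and let Y' ⊆ X' be feasible such that |Y'| equals the maximum cardinality of a feasible subset of X', but Y' does not maximize total weight among feasible subsets of X' (i.e., there is a feasible Z ⊆ X' with w(Z) > w(Y')). Then there exist x ∈ X' \ Y' and y ∈ Y' such that (Y' ∪ {x}) \ {y} is feasible and w(x) > w(y). -/

import Mathlib

/-- The `i`-th standard unit vector in `ℕ^m`. -/
def chi {m : ℕ} (i : Fin m) : Fin m → ℕ := fun j => if j = i then 1 else 0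

/-- A family `F ⊆ ℕ^m` is hereditary if it contains `0` and is downward closed
with respect to the componentwise order. -/
def Hereditary {m : ℕ} (F : Set (Fin m → ℕ)) : Prop :=
  (0 : Fin m → ℕ) ∈ F ∧ ∀ ν ∈ F, ∀ ν' : Fin m → ℕ, ν' ≤ ν → ν' ∈ F

/-- `F ⊆ ℕ^m` is an M♮-convex set: for all `ν, ν' ∈ F` and every index `i` with
`ν i > ν' i`, either (`ν − χᵢ ∈ F` and `ν' + χᵢ ∈ F`) or there exists `j` with
`ν j < ν' j` such that `ν − χᵢ + χⱼ ∈ F` and `ν' + χᵢ − χⱼ ∈ F`. -/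
def MNatConvex {m : ℕ} (F : Set (Fin m → ℕ)) : Prop :=
  ∀ ν ∈ F, ∀ ν' ∈ F, ∀ i : Fin m, ν' i < ν i →
    ((ν - chi i ∈ F ∧ ν' + chi i ∈ F) ∨
      ∃ j : Fin m, ν j < ν' j ∧ ν - chi i + chi j ∈ F ∧ ν' + chi i - chi j ∈ F)

/-- The vector of numbers of contracts in `Y` assigned to each college. -/
def nu {ι : Type*} [DecidableEq ι] {m : ℕ} (col : ι → Fin m) (Y : Finset ι) :
    Fin m → ℕ := fun i => (Y.filter (fun x => col x = i)).card

theorem nu_insert {ι : Type*} [DecidableEq ι] {m : ℕ} (col : ι → Fin m) {Y : Finset ι} {x : ι}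
    (hx : x ∉ Y) : nu col (insert x Y) = nu col Y + chi (col x) := by
  ext i
  simp only [nu, chi, Pi.add_apply, Finset.filter_insert]
  by_cases h : col x = i
  · simp [h, hx]
  · simp [h, Ne.symm h]

theorem nu_erase {ι : Type*} [DecidableEq ι] {m : ℕ} (col : ι → Fin m) {Y : Finset ι} {x : ι}
    (hx : x ∈ Y) : nu col (Y.erase x) = nu col Y - chi (col x) := by
  have h := nu_insert col (Finset.notMem_erase x Y)
  rw [Finset.insert_erase hx] at h
  rw [h]
  ext i
  simp

theorem exists_mem_sdiff_of_nu_lt {ι : Type*} [DecidableEq ι] {m : ℕ} (col : ι → Fin m)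
    {A B : Finset ι} {j : Fin m} (h : nu col A j < nu col B j) :
    ∃ y ∈ B, y ∉ A ∧ col y = j := by
  obtain ⟨y, hyB, hyA⟩ := Finset.exists_mem_notMem_of_card_lt_card h
  simp only [Finset.mem_filter] at hyB hyA
  exact ⟨y, hyB.1, fun hy => hyA ⟨hy, hyB.2⟩, hyB.2⟩

/-- The feasible sets of contracts inherit the exchange property of an M♮-convex set. -/
theorem MNatConvex.exchange {m : ℕ} {F : Set (Fin m → ℕ)} (hM : MNatConvex F) {ι : Type*}
    [DecidableEq ι] (col : ι → Fin m) {A B : Finset ι} (hA : nu col A ∈ F) (hB : nu col B ∈ F)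
    {x : ι} (hxA : x ∈ A) (hxB : x ∉ B) :
    nu col (insert x B) ∈ F ∨
      ∃ y ∈ B, y ∉ A ∧ nu col (insert y (A.erase x)) ∈ F ∧
        nu col ((insert x B).erase y) ∈ F := by
  have swap {y : ι} (hyB : y ∈ B) (hyA : y ∉ A) :
      nu col (insert y (A.erase x)) = nu col A - chi (col x) + chi (col y) ∧
        nu col ((insert x B).erase y) = nu col B + chi (col x) - chi (col y) := by
    rw [nu_insert col (fun h => hyA (Finset.mem_of_mem_erase h)), nu_erase col hxA,
      nu_erase col (Finset.mem_insert_of_mem hyB), nu_insert col hxB]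
    exact ⟨rfl, rfl⟩
  rcases lt_or_ge (nu col B (col x)) (nu col A (col x)) with h | h
  · rcases hM _ hA _ hB _ h with ⟨-, h⟩ | ⟨j, hj, h₁, h₂⟩
    · exact .inl (by rwa [nu_insert col hxB])
    · obtain ⟨y, hyB, hyA, rfl⟩ := exists_mem_sdiff_of_nu_lt col hj
      obtain ⟨e₁, e₂⟩ := swap hyB hyA
      exact .inr ⟨y, hyB, hyA, e₁ ▸ h₁, e₂ ▸ h₂⟩
  · have hlt : nu col (A.erase x) (col x) < nu col B (col x) := by
      refine lt_of_lt_of_le (Finset.card_lt_card ?_) h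
      rw [Finset.filter_erase]
      exact Finset.erase_ssubset (by simp [hxA])
    obtain ⟨y, hyB, hyA, hy⟩ := exists_mem_sdiff_of_nu_lt col hlt
    have hyA : y ∉ A := fun h' => hyA (Finset.mem_erase.2 ⟨fun e => hxB (e ▸ hyB), h'⟩)
    obtain ⟨e₁, e₂⟩ := swap hyB hyA
    refine .inr ⟨y, hyB, hyA, ?_, ?_⟩
    · rw [e₁, hy, ← nu_erase col hxA, ← nu_insert col (Finset.notMem_erase x A),
        Finset.insert_erase hxA]
      exact hA
    · rw [e₂, hy, add_tsub_cancel_right]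
      exact hB

/-- Let `F` be a hereditary M♮-convex set and `w` injective and positive.
If `Y' ⊆ X'` is feasible, has maximum cardinality among feasible subsets of `X'`, but
does not maximize total weight among feasible subsets of `X'`, then there exist
`x ∈ X' \ Y'` and `y ∈ Y'` such that `(Y' ∪ {x}) \ {y}` is feasible and `w x > w y`. -/
theorem max_card_not_max_weight_exchange {m : ℕ} (F : Set (Fin m → ℕ)) (hF : Hereditary F)
    (hM : MNatConvex F) {ι : Type*} [Fintype ι] [DecidableEq ι] (col : ι → Fin m)
    (w : ι → ℝ) (hwinj : Function.Injective w) (hwpos : ∀ x : ι, 0 < w x)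
    (X' Y' : Finset ι) (hYX : Y' ⊆ X') (hYfeas : nu col Y' ∈ F)
    (hmaxcard : ∀ Z ⊆ X', nu col Z ∈ F → Z.card ≤ Y'.card)
    (hnotopt : ∃ Z ⊆ X', nu col Z ∈ F ∧ ∑ x ∈ Y', w x < ∑ x ∈ Z, w x) :
    ∃ x ∈ X' \ Y', ∃ y ∈ Y',
      nu col ((insert x Y').erase y) ∈ F ∧ w y < w x := by
  obtain ⟨Z, hZX, hZ, hlt⟩ := hnotopt
  induction hn : (Z \ Y').card generalizing Z with
  | zero =>
    have hsub : Z ⊆ Y' := Finset.sdiff_eq_empty_iff_subset.1 (Finset.card_eq_zero.1 hn)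
    exact absurd hlt
      (Finset.sum_le_sum_of_subset_of_nonneg hsub fun x _ _ => (hwpos x).le).not_gt
  | succ n ih =>
    obtain ⟨x, hx⟩ := Finset.card_pos.1 (hn.symm ▸ Nat.succ_pos n : 0 < (Z \ Y').card)
    obtain ⟨hxZ, hxY⟩ := Finset.mem_sdiff.1 hx
    rcases hM.exchange col hZ hYfeas hxZ hxY with h | ⟨y, hyY, hyZ, h₁, h₂⟩
    · have hcard := hmaxcard _ (Finset.insert_subset (hZX hxZ) hYX) h
      rw [Finset.card_insert_of_notMem hxY] at hcard
      omega
    rcases lt_or_ge (w y) (w x) with hxy | hxy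
    · exact ⟨x, Finset.mem_sdiff.2 ⟨hZX hxZ, hxY⟩, y, hyY, h₂, hxy⟩
    refine ih (insert y (Z.erase x))
      (Finset.insert_subset (hYX hyY) ((Finset.erase_subset x Z).trans hZX)) h₁ ?_ ?_
    · rw [Finset.sum_insert fun h => hyZ (Finset.mem_of_mem_erase h)]
      linarith [Finset.add_sum_erase Z w hxZ]
    · rw [Finset.insert_sdiff_of_mem _ hyY, Finset.erase_sdiff_comm,
        Finset.card_erase_of_mem hx, hn, Nat.add_sub_cancel]
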